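/- Let T = (T_1, …, T_N) with X := T_1. Let μ = P + V_0(T) + Σ_{i≥1} V_i(T) P^{−i} be a Laurent series in P^{−1} with smooth coefficients, and let M := Σ_{n=1}^{N} n T_n μ^{n−1} + Σ_{i≥1} S_i(T) μ^{−i} with smooth functions S_i (the Orlov function of dmKP). Let f(P,X) and g(P,X) be Laurent polynomials in P with coefficients polynomial in X satisfying the canonical relation {f, g} := (∂f/∂P)(∂g/∂X) − (∂f/∂X)(∂g/∂P) = 1. Suppose the functional equations f(μ, M)_{≤0} = 0 and g(μ, M)_{≤−1} = 0 hold, where f(μ,M) denotes the substitution P ↦ μ, X ↦ M. Then the pair (μ, M) solves the dmKP hierarchy: for each n = 1,…,N, ∂_{T_n}μ = {(μ^n)_{≥1}, μ}, ∂_{T_n}M = {(μ^n)_{≥1}, M}, and {μ, M} = 1. -/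

import Mathlib

namespace DMKP

/-- Coefficient functions of a formal Laurent series in `P⁻¹` with time variables
`T = (T₁, …, T_N)`: `A n` is the coefficient of `P^n`. -/
abbrev Coeffs (N : ℕ) := ℤ → (Fin N → ℝ) → ℝ

variable {N : ℕ}

/-- Partial derivative in the direction of the `q`-th time variable. -/
noncomputable def pd (q : Fin N) (f : (Fin N → ℝ) → ℝ) : (Fin N → ℝ) → ℝ :=
  fun x => fderiv ℝ f x (Pi.single q 1)

/-- Finitely many positive powers of `P`. -/
def BddPow (A : Coeffs N) : Prop := ∃ m : ℤ, ∀ n : ℤ, m < n → A n = 0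

/-- All coefficients are smooth functions of the time variables. -/
def SmoothCoeffs (A : Coeffs N) : Prop := ∀ n : ℤ, ContDiff ℝ (⊤ : ℕ∞) (A n)

/-- A Laurent series in `P⁻¹` with smooth coefficients. -/
def IsLaurent (A : Coeffs N) : Prop := BddPow A ∧ SmoothCoeffs A

/-- Termwise `∂_P`. -/
def dP (A : Coeffs N) : Coeffs N := fun n x => ((n + 1 : ℤ) : ℝ) * A (n + 1) x

/-- Termwise `∂_{T_q}`. -/
noncomputable def dT (q : Fin N) (A : Coeffs N) : Coeffs N := fun n => pd q (A n)

/-- Termwise `∂_X`, where `X = T₁`. -/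
noncomputable def dX [NeZero N] (A : Coeffs N) : Coeffs N := dT 0 A

/-- Termwise product of Laurent series. -/
noncomputable def mul (A B : Coeffs N) : Coeffs N := fun n x => ∑' i : ℤ, A i x * B (n - i) x

/-- The Poisson bracket `{f,g} = f_P g_X - f_X g_P`. -/
noncomputable def pb [NeZero N] (A B : Coeffs N) : Coeffs N :=
  fun n x => mul (dP A) (dX B) n x - mul (dX A) (dP B) n x

/-- Truncation keeping only powers `P^n` with `n ≥ k`. -/
def truncGe (k : ℤ) (A : Coeffs N) : Coeffs N := fun n => if k ≤ n then A n else 0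

/-- Truncation keeping only powers `P^n` with `n ≤ k`. -/
def truncLe (k : ℤ) (A : Coeffs N) : Coeffs N := fun n => if n ≤ k then A n else 0

/-- The residue: coefficient of `P⁻¹`. -/
def res (A : Coeffs N) : (Fin N → ℝ) → ℝ := A (-1)

/-- The constant Laurent series `1`. -/
def one' : Coeffs N := fun n => if n = 0 then (fun _ => (1 : ℝ)) else 0

/-- `powC A q` is the `q`-th power `A^q`. -/
noncomputable def powC (A : Coeffs N) : ℕ → Coeffs N
  | 0 => one'
  | q + 1 => mul A (powC A q)

/-- `e^{-ad φ} A = Σ_{k≥0} (1/k!) (φ_X)^k ∂_P^k A`. -/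
noncomputable def expAdNeg [NeZero N] (φ : (Fin N → ℝ) → ℝ) (A : Coeffs N) : Coeffs N :=
  fun n x => ∑' k : ℕ, (pd 0 φ x) ^ k / (Nat.factorial k : ℝ) * (dP^[k] A) n x

/-- `e^{ad φ} A = Σ_{k≥0} (1/k!) (-φ_X)^k ∂_P^k A`. -/
noncomputable def expAdPos [NeZero N] (φ : (Fin N → ℝ) → ℝ) (A : Coeffs N) : Coeffs N :=
  fun n x => ∑' k : ℕ, (-(pd 0 φ x)) ^ k / (Nat.factorial k : ℝ) * (dP^[k] A) n x

/-- A `P`-independent function viewed as a Laurent series concentrated at `P^0`. -/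
def const (φ : (Fin N → ℝ) → ℝ) : Coeffs N := fun n => if n = 0 then φ else 0

/-- Evaluation of the polynomial (non-negative) part of `A` at `P = φ_X`. -/
noncomputable def evalAtPhiX [NeZero N] (A : Coeffs N) (φ : (Fin N → ℝ) → ℝ) :
    (Fin N → ℝ) → ℝ :=
  fun x => ∑' k : ℕ, A (k : ℤ) x * (pd 0 φ x) ^ k

/-- The shape `λ = P + U₂ P⁻¹ + U₃ P⁻² + ⋯` of the dKP Lax function. -/
def IsDKPShape (lam : Coeffs N) : Prop :=
  (lam 1 = fun _ => (1 : ℝ)) ∧ lam 0 = 0 ∧ ∀ n : ℤ, 2 ≤ n → lam n = 0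

/-- The shape `μ = P + V₀ + V₁ P⁻¹ + ⋯` of the dmKP Lax function. -/
def IsDMKPShape (mu : Coeffs N) : Prop :=
  (mu 1 = fun _ => (1 : ℝ)) ∧ ∀ n : ℤ, 2 ≤ n → mu n = 0


/-- `μ^j` for `j : ℤ`, given an inverse `μ⁻¹`. -/
noncomputable def zpowPair {N : ℕ} (mu muinv : Coeffs N) (j : ℤ) : Coeffs N :=
  if 0 ≤ j then powC mu j.toNat else powC muinv (-j).toNat

/-- The Orlov function `M = Σ_{n=1}^N n T_n μ^{n-1} + Σ_{i≥1} S_i μ^{-i}` of dmKP. -/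
noncomputable def orlov {N : ℕ} (mu muinv : Coeffs N) (S : ℕ → (Fin N → ℝ) → ℝ) :
    Coeffs N :=
  fun n x => (∑ q : Fin N, (((q : ℕ) + 1 : ℕ) : ℝ) * x q * powC mu (q : ℕ) n x)
    + ∑' i : ℕ, S (i + 1) x * powC muinv (i + 1) n x

/-- A Laurent polynomial `f(P,X) = Σ c_{jk} P^j X^k` (finitely many terms, coefficients
polynomial in `X`) viewed as a Laurent series whose coefficients depend only on `X = T₁`. -/
noncomputable def polyToCoeffs {N : ℕ} [NeZero N] (f : ℤ →₀ Polynomial ℝ) : Coeffs N :=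
  fun n x => (f n).eval (x 0)

/-- Substitution `P ↦ μ`, `X ↦ M` into a Laurent polynomial `f(P,X)`. -/
noncomputable def substC {N : ℕ} (f : ℤ →₀ Polynomial ℝ) (mu muinv M : Coeffs N) :
    Coeffs N :=
  fun n x => ∑ j ∈ f.support, ∑ k ∈ (f j).support,
    (f j).coeff k * mul (zpowPair mu muinv j) (powC M k) n x

/-- The algebra of smooth real functions of the time variables. -/
def smoothFn (N : ℕ) : Subalgebra ℝ ((Fin N → ℝ) → ℝ) where
  carrier := {f | ContDiff ℝ (⊤ : ℕ∞) f}
  mul_mem' hf hg := by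
    rw [Set.mem_ofPred_eq] at *
    exact hf.mul hg
  add_mem' hf hg := by
    rw [Set.mem_ofPred_eq] at *
    exact hf.add hg
  algebraMap_mem' r := by
    rw [Set.mem_ofPred_eq]
    exact contDiff_const (c := r)

theorem mem_smoothFn {f : (Fin N → ℝ) → ℝ} : f ∈ smoothFn N ↔ ContDiff ℝ (⊤ : ℕ∞) f :=
  Set.mem_ofPred_eq ▸ Iff.rfl

/-- Laurent series in `P⁻¹` with smooth coefficients, the formal variable being `P⁻¹`. -/
abbrev Ser (N : ℕ) := HahnSeries ℤ (smoothFn N)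

/-- The coefficientwise algebra structure, preferred to the one induced from power series. -/
noncomputable instance (priority := 2000) serAlgebra {R : Type*} [CommRing R] [Algebra ℝ R] :
    Algebra ℝ (HahnSeries ℤ R) :=
  HahnSeries.instAlgebra

theorem differentiable_smoothFn (f : smoothFn N) : Differentiable ℝ (f : (Fin N → ℝ) → ℝ) :=
  (mem_smoothFn.1 f.2).differentiable (by simp)

/-- The partial derivative `∂_{T_q}` of smooth functions, as a derivation. -/
noncomputable def pdDer (q : Fin N) : Derivation ℝ (smoothFn N) (smoothFn N) :=
  Derivation.mk'
    { toFun := fun f => ⟨pd q f, mem_smoothFn.2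
        (((mem_smoothFn.1 f.2).fderiv_right (m := (⊤ : ℕ∞)) (by simp)).clm_apply contDiff_const)⟩
      map_add' := fun f g => by
        ext x
        simp [pd, fderiv_add (differentiable_smoothFn f x) (differentiable_smoothFn g x)]
      map_smul' := fun c f => by
        ext x
        simp [pd, fderiv_const_smul (differentiable_smoothFn f x)] }
    (fun f g => by
      ext x
      simp [pd, fderiv_mul (differentiable_smoothFn f x) (differentiable_smoothFn g x)])

/-- The coefficientwise action of a family of linear maps on Laurent series. -/
def coeffMap {R : Type*} [CommRing R] [Algebra ℝ R] (e : ℤ → R →ₗ[ℝ] R) :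
    HahnSeries ℤ R →ₗ[ℝ] HahnSeries ℤ R where
  toFun a := ⟨fun n => e n (a.coeff n), a.isPWO_support.mono fun n => by
    rw [HahnSeries.mem_support, Function.mem_support]
    exact fun hn h0 => hn (by rw [h0, map_zero])⟩
  map_add' a b := by ext n; simp
  map_smul' c a := by ext n; simp

theorem support_coeffMap_subset {R : Type*} [CommRing R] [Algebra ℝ R] (e : ℤ → R →ₗ[ℝ] R)
    (a : HahnSeries ℤ R) : (coeffMap e a).support ⊆ a.support := fun n => by
  rw [HahnSeries.mem_support, HahnSeries.mem_support]
  exact fun hn h0 => hn (by simp [coeffMap, h0])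

/-- A graded family of linear maps satisfying the Leibniz rule acts coefficientwise as a derivation
of the ring of Laurent series. -/
noncomputable def coeffDer {R : Type*} [CommRing R] [Algebra ℝ R] (e : ℤ → R →ₗ[ℝ] R)
    (he : ∀ i j x y, e (i + j) (x * y) = x * e j y + y * e i x) :
    Derivation ℝ (HahnSeries ℤ R) (HahnSeries ℤ R) :=
  Derivation.mk' (coeffMap e) fun a b => by
    ext n
    rw [smul_eq_mul, smul_eq_mul, mul_comm b, HahnSeries.coeff_add,
      HahnSeries.coeff_mul_right' b.isPWO_support (support_coeffMap_subset e b),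
      HahnSeries.coeff_mul_left' a.isPWO_support (support_coeffMap_subset e a),
      ← Finset.sum_add_distrib]
    change e n ((a * b).coeff n) = _
    rw [HahnSeries.coeff_mul, map_sum]
    refine Finset.sum_congr rfl fun ij hij => ?_
    rw [← ((Finset.mem_antidiagonal ..).1 hij).2.2, he, mul_comm (b.coeff _)]
    rfl

theorem coeffDer_coeff {R : Type*} [CommRing R] [Algebra ℝ R] (e : ℤ → R →ₗ[ℝ] R)
    (he : ∀ i j x y, e (i + j) (x * y) = x * e j y + y * e i x) (a : HahnSeries ℤ R) (n : ℤ) :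
    (coeffDer e he a).coeff n = e n (a.coeff n) := rfl

/-- The derivation `∂_{T_q}` of Laurent series. -/
noncomputable def derT (q : Fin N) : Derivation ℝ (Ser N) (Ser N) :=
  coeffDer (fun _ => (pdDer q : smoothFn N →ₗ[ℝ] smoothFn N)) (by simp)

/-- The multiple of a derivation by a ring element. -/
def mulDer {B : Type*} [CommRing B] [Algebra ℝ B] (c : B) (D : Derivation ℝ B B) :
    Derivation ℝ B B :=
  c • D

/-- The derivation `∂_P` of Laurent series. -/
noncomputable def derP : Derivation ℝ (Ser N) (Ser N) :=
  mulDer (HahnSeries.single 1 1)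
    (coeffDer (R := smoothFn N) (fun n => (-(n : ℝ)) • LinearMap.id) (by
      intro i j x y
      simp only [LinearMap.smul_apply, LinearMap.id_apply, mul_smul_comm, mul_comm y x,
        ← add_smul]
      congr 1
      push_cast
      ring))

/-- The coefficient functions of a Laurent series, indexed by powers of `P`. -/
def toC (a : Ser N) : Coeffs N := fun n => a.coeff (-n)

theorem toC_injective : Function.Injective (toC : Ser N → Coeffs N) := by
  intro a b h
  ext n : 2
  exact Subtype.ext (by simpa [toC] using congrFun h (-n))

theorem exists_toC_eq {A : Coeffs N} (hA : IsLaurent A) : ∃ a : Ser N, toC a = A := by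
  obtain ⟨⟨m, hm⟩, hs⟩ := hA
  refine ⟨HahnSeries.ofSuppBddBelow (fun n => ⟨A (-n), mem_smoothFn.2 (hs _)⟩)
    ⟨-m, fun n hn => ?_⟩, ?_⟩
  · by_contra hlt
    exact hn (Subtype.ext (hm _ (by omega)))
  · funext n
    exact congrArg A (neg_neg n)

theorem toC_one : toC (1 : Ser N) = one' := by
  funext n
  by_cases h : n = 0 <;> simp [toC, one', HahnSeries.coeff_one, h]; rfl

theorem toC_mul (a b : Ser N) : toC (a * b) = mul (toC a) (toC b) := by
  funext n x
  simp only [toC, mul]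
  rw [HahnSeries.coeff_mul, tsum_eq_sum (s := (Finset.antidiagonal a.isPWO_support
    b.isPWO_support (-n)).image fun ij => -ij.1)]
  · rw [Finset.sum_image]
    · simp only [AddSubmonoidClass.coe_finsetSum, Finset.sum_apply]
      refine Finset.sum_congr rfl fun ij hij => ?_
      have h := ((Finset.mem_antidiagonal ..).1 hij).2.2
      rw [neg_neg, show -(n - -ij.1) = ij.2 by omega]
      rfl
    · rintro ⟨i, j⟩ hi ⟨k, l⟩ hk h
      have h1 := ((Finset.mem_antidiagonal ..).1 (Finset.mem_coe.1 hi)).2.2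
      have h2 := ((Finset.mem_antidiagonal ..).1 (Finset.mem_coe.1 hk)).2.2
      simp only at h h1 h2
      ext <;> simp only <;> omega
  · intro i hi
    by_contra hne
    refine hi (Finset.mem_image.2 ⟨(-i, -(n - i)), ?_, by simp⟩)
    refine (Finset.mem_antidiagonal ..).2 ⟨?_, ?_, by simp only; omega⟩ <;>
      · intro h0
        simp only at h0
        simp [-neg_sub, h0] at hne

theorem toC_derT (q : Fin N) (a : Ser N) : toC (derT q a) = dT q (toC a) := rfl

theorem toC_derP (a : Ser N) : toC (derP a) = dP (toC a) := by
  funext n x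
  have : (derP a).coeff (-n) = (-((-n - 1 : ℤ) : ℝ)) • a.coeff (-n - 1) := by
    change (HahnSeries.single 1 1 * coeffDer _ _ a).coeff (-n) = _
    rw [HahnSeries.coeff_single_mul, one_mul, coeffDer_coeff]
    rfl
  simp only [toC, this, dP]
  rw [show -(n + 1) = -n - 1 by ring]
  simp only [SetLike.val_smul, Pi.smul_apply, smul_eq_mul]
  push_cast
  ring

theorem toC_pow (a : Ser N) (k : ℕ) : toC (a ^ k) = powC (toC a) k := by
  induction k with
  | zero => rw [pow_zero, toC_one]; rfl
  | succ k ih => rw [pow_succ', toC_mul, ih]; rfl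

theorem toC_add (a b : Ser N) : toC (a + b) = toC a + toC b := rfl

theorem toC_sub (a b : Ser N) : toC (a - b) = toC a - toC b := rfl

/-- The Poisson bracket of Laurent series. -/
noncomputable def pbr [NeZero N] (a b : Ser N) : Ser N := derP a * derT 0 b - derT 0 a * derP b

theorem toC_pbr [NeZero N] (a b : Ser N) : toC (pbr a b) = pb (toC a) (toC b) := by
  rw [pbr, toC_sub, toC_mul, toC_mul, toC_derP, toC_derP, toC_derT, toC_derT]
  rfl

section Substitution

open Polynomial LaurentPolynomial

variable {B : Type*} [CommRing B] [Algebra ℝ B]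

theorem derivation_units_zpow (D : Derivation ℝ B B) (u : Bˣ) (j : ℤ) :
    D ((u ^ j : Bˣ) : B) = (j : B) * ((u ^ (j - 1) : Bˣ) : B) * D (u : B) := by
  have step (k : ℤ) : ((u ^ (k + 1) : Bˣ) : B) = ((u ^ k : Bˣ) : B) * u := by
    rw [zpow_add_one, Units.val_mul]
  induction j using Int.induction_on with
  | zero => simp
  | succ k ih =>
    have h := step (k - 1)
    rw [sub_add_cancel] at h
    rw [step, D.leibniz, ih, add_sub_cancel_right, h]
    push_cast
    simp only [smul_eq_mul]
    ring
  | pred k ih =>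
    have h1 := step (-k - 1)
    have h2 := step (-k - 1 - 1)
    rw [sub_add_cancel] at h1 h2
    rw [h1, D.leibniz, h2] at ih
    rw [← u.mul_left_inj, h2]
    simp only [smul_eq_mul] at ih
    push_cast at ih ⊢
    linear_combination ih

/-- Substitution of a unit for `P` and of an element for `X` in a Laurent polynomial. -/
noncomputable def evalL (u : Bˣ) (m : B) : ℝ[X][T;T⁻¹] →+* B :=
  LaurentPolynomial.eval₂ (aeval m : ℝ[X] →ₐ[ℝ] B).toRingHom u

/-- The Laurent polynomial with prescribed coefficients. -/
noncomputable def lp (f : ℤ →₀ ℝ[X]) : ℝ[X][T;T⁻¹] :=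
  f.sum fun j p => LaurentPolynomial.C p * T j

/-- The derivative of a Laurent polynomial with respect to `P`. -/
noncomputable def lpP (f : ℤ →₀ ℝ[X]) : ℝ[X][T;T⁻¹] :=
  f.sum fun j p => LaurentPolynomial.C ((j : ℝ[X]) * p) * T (j - 1)

/-- The derivative of a Laurent polynomial with respect to `X`. -/
noncomputable def lpX (f : ℤ →₀ ℝ[X]) : ℝ[X][T;T⁻¹] :=
  f.sum fun j p => LaurentPolynomial.C (derivative p) * T j

theorem lp_coeff (h : ℝ[X][T;T⁻¹]) : lp h.coeff = h := by
  simp only [lp, ← LaurentPolynomial.single_eq_C_mul_T]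
  exact AddMonoidAlgebra.sum_coeff_single h

theorem evalL_C_mul_T (u : Bˣ) (m : B) (p : ℝ[X]) (j : ℤ) :
    evalL u m (LaurentPolynomial.C p * T j) = aeval m p * ((u ^ j : Bˣ) : B) :=
  LaurentPolynomial.eval₂_C_mul_T ..

theorem evalL_lp (u : Bˣ) (m : B) (f : ℤ →₀ ℝ[X]) :
    evalL u m (lp f) = f.sum fun j p => aeval m p * ((u ^ j : Bˣ) : B) := by
  simp only [lp, map_finsuppSum, evalL_C_mul_T]

/-- The chain rule for substitution into a Laurent polynomial. -/
theorem derivation_evalL_lp (D : Derivation ℝ B B) (u : Bˣ) (m : B) (f : ℤ →₀ ℝ[X]) :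
    D (evalL u m (lp f)) = evalL u m (lpP f) * D (u : B) + evalL u m (lpX f) * D m := by
  simp only [evalL_lp, lpP, lpX, map_finsuppSum, evalL_C_mul_T]
  simp only [Finsupp.sum, Finset.sum_mul, ← Finset.sum_add_distrib]
  refine Finset.sum_congr rfl fun j _ => ?_
  rw [D.leibniz, D.map_aeval, derivation_units_zpow, map_mul, map_intCast]
  simp only [smul_eq_mul]
  ring

end Substitution

/-- The variable `P` as a unit of the ring of Laurent series. -/
noncomputable def pUnit : (Ser N)ˣ :=
  ⟨HahnSeries.single (-1) 1, HahnSeries.single 1 1, by simp, by simp⟩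

theorem pUnit_zpow (j : ℤ) : ((pUnit ^ j : (Ser N)ˣ) : Ser N) = HahnSeries.single (-j) 1 := by
  induction j using Int.induction_on with
  | zero => simp
  | succ k ih =>
    rw [zpow_add_one, Units.val_mul, ih]
    simp only [pUnit]
    rw [HahnSeries.single_mul_single, mul_one, neg_add]
  | pred k ih =>
    rw [zpow_sub_one, Units.val_mul, ih]
    simp only [pUnit, Units.inv_mk]
    rw [HahnSeries.single_mul_single, mul_one]
    congr 2
    ring

/-- The time variable `T_q` as a constant Laurent series. -/
noncomputable def tSer (q : Fin N) : Ser N :=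
  HahnSeries.C ⟨fun x => x q, mem_smoothFn.2 (contDiff_apply ℝ ℝ q)⟩

theorem toC_tSer (q : Fin N) (n : ℤ) :
    toC (tSer q) n = if n = 0 then (fun x => x q) else (0 : (Fin N → ℝ) → ℝ) := by
  by_cases h : n = 0 <;> simp [toC, tSer, h]

theorem derP_tSer (q : Fin N) : derP (tSer q) = 0 := by
  apply toC_injective
  rw [toC_derP]
  funext n x
  by_cases h : n + 1 = 0
  · simp [dP, h, toC]
  · rw [dP, toC_tSer, if_neg h]
    exact mul_zero _

theorem pd_zero (q : Fin N) : pd q (0 : (Fin N → ℝ) → ℝ) = 0 := by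
  funext x
  simp [pd]

theorem derT_tSer (p q : Fin N) : derT p (tSer q) = if p = q then 1 else 0 := by
  apply toC_injective
  rw [toC_derT]
  funext n
  simp only [dT, toC_tSer]
  by_cases h : n = 0
  · subst h
    funext x
    have : fderiv ℝ (fun x : Fin N → ℝ => x q) x = ContinuousLinearMap.proj q :=
      (ContinuousLinearMap.proj (R := ℝ) (φ := fun _ : Fin N => ℝ) q).fderiv
    by_cases hpq : p = q
    · subst hpq
      simp [pd, this, toC]
    · simp [pd, this, toC, hpq, Ne.symm hpq]
  · rw [if_neg h, pd_zero]
    split_ifs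
    · simp [toC_one, one', h]
    · rfl

theorem derP_pUnit : derP ((pUnit : (Ser N)ˣ) : Ser N) = 1 := by
  apply toC_injective
  rw [toC_derP, toC_one]
  funext n x
  by_cases h : n = 0
  · subst h
    simp [dP, pUnit, toC, one']
  · simp [dP, pUnit, toC, one', h]

theorem derT_pUnit (q : Fin N) : derT q ((pUnit : (Ser N)ˣ) : Ser N) = 0 := by
  apply toC_injective
  rw [toC_derT]
  funext n x
  by_cases h : n = 1
  · subst h
    simp [dT, pUnit, toC, pd]
  · simp [dT, pUnit, toC, pd, h]

theorem toC_sum {ι : Type*} (s : Finset ι) (f : ι → Ser N) :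
    toC (∑ i ∈ s, f i) = ∑ i ∈ s, toC (f i) :=
  map_sum (⟨⟨toC, rfl⟩, toC_add⟩ : Ser N →+ Coeffs N) f s

theorem aeval_smoothFn_apply (c : smoothFn N) (p : Polynomial ℝ) (x : Fin N → ℝ) :
    (Polynomial.aeval c p : smoothFn N).1 x = p.eval (c.1 x) := by
  rw [← Polynomial.coe_aeval_eq_eval]
  exact (Polynomial.aeval_algHom_apply ((Pi.evalAlgHom ℝ (fun _ => ℝ) x).comp (smoothFn N).val)
    c p).symm

theorem aeval_C_smoothFn (c : smoothFn N) (p : Polynomial ℝ) :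
    Polynomial.aeval (HahnSeries.C c : Ser N) p = HahnSeries.C (Polynomial.aeval c p) :=
  Polynomial.aeval_algHom_apply
    ({ toRingHom := HahnSeries.C, commutes' := fun _ => rfl } : smoothFn N →ₐ[ℝ] Ser N) c p

theorem toC_evalL_pUnit [NeZero N] (f : ℤ →₀ Polynomial ℝ) :
    toC (evalL pUnit (tSer 0) (lp f)) = polyToCoeffs (N := N) f := by
  funext n x
  rw [evalL_lp, Finsupp.sum, toC_sum, Finset.sum_apply, Finset.sum_apply, polyToCoeffs,
    Finset.sum_eq_single n]
  · rw [tSer, aeval_C_smoothFn, pUnit_zpow]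
    simp [toC, aeval_smoothFn_apply]
  · intro j _ hj
    rw [tSer, aeval_C_smoothFn, pUnit_zpow]
    simp [toC, hj.symm]
  · intro h
    simp [Finsupp.notMem_support_iff.1 h, toC]

theorem evalL_pUnit_injective [NeZero N] :
    Function.Injective (evalL (pUnit : (Ser N)ˣ) (tSer 0)) := by
  intro h₁ h₂ h
  rw [← lp_coeff h₁, ← lp_coeff h₂] at h
  have h' := congrArg toC h
  rw [toC_evalL_pUnit, toC_evalL_pUnit] at h'
  ext n : 1
  exact Polynomial.funext fun r => congrFun (congrFun h' n) fun _ => r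

/-- The chain rule in the ring of Laurent series. -/
theorem der_evalL_lp (D : Derivation ℝ (Ser N) (Ser N)) (u : (Ser N)ˣ) (m : Ser N)
    (f : ℤ →₀ Polynomial ℝ) :
    D (evalL u m (lp f)) = evalL u m (lpP f) * D (u : Ser N) + evalL u m (lpX f) * D m :=
  derivation_evalL_lp D u m f

/-- The canonical relation as an identity between Laurent polynomials. -/
theorem canonical_lp [NeZero N] {f g : ℤ →₀ Polynomial ℝ}
    (hcanon : pb (polyToCoeffs (N := N) f) (polyToCoeffs g) = one') :
    lpP f * lpX g - lpX f * lpP g = 1 := by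
  apply evalL_pUnit_injective (N := N)
  rw [map_one, map_sub, map_mul, map_mul]
  rw [← toC_evalL_pUnit, ← toC_evalL_pUnit, ← toC_pbr, ← toC_one] at hcanon
  rw [← toC_injective hcanon, pbr]
  rw [der_evalL_lp, der_evalL_lp, der_evalL_lp, der_evalL_lp, derP_pUnit, derT_pUnit, derP_tSer,
    derT_tSer, if_pos rfl]
  ring

theorem toC_units_zpow (u : (Ser N)ˣ) (j : ℤ) :
    toC ((u ^ j : (Ser N)ˣ) : Ser N) = zpowPair (toC u) (toC (u⁻¹ : (Ser N)ˣ)) j := by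
  unfold zpowPair
  split_ifs with hj
  · rw [← toC_pow, ← Units.val_pow_eq_pow_val, ← zpow_natCast, Int.toNat_of_nonneg hj]
  · rw [← toC_pow, ← Units.val_pow_eq_pow_val, ← zpow_natCast, Int.toNat_of_nonneg (by omega),
      inv_zpow', neg_neg]

theorem toC_evalL_lp (u : (Ser N)ˣ) (m : Ser N) (f : ℤ →₀ Polynomial ℝ) :
    toC (evalL u m (lp f)) = substC f (toC u) (toC (u⁻¹ : (Ser N)ˣ)) (toC m) := by
  funext n x
  rw [evalL_lp, Finsupp.sum, toC_sum, Finset.sum_apply, Finset.sum_apply, substC]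
  refine Finset.sum_congr rfl fun j _ => ?_
  rw [Polynomial.aeval_def, Polynomial.eval₂_eq_sum, Polynomial.sum_def, Finset.sum_mul, toC_sum,
    Finset.sum_apply, Finset.sum_apply]
  refine Finset.sum_congr rfl fun k _ => ?_
  rw [← toC_units_zpow, ← toC_pow, ← toC_mul, ← Algebra.smul_def, smul_mul_assoc, mul_comm]
  rfl

/-- Only powers `P^n` with `n ≤ k` occur. -/
def LeP (k : ℤ) (a : Ser N) : Prop := ∀ n, k < n → toC a n = 0

/-- Only powers `P^n` with `n ≥ k` occur. -/
def GeP (k : ℤ) (a : Ser N) : Prop := ∀ n, n < k → toC a n = 0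

theorem LeP.mono {k l : ℤ} {a : Ser N} (ha : LeP k a) (h : k ≤ l) : LeP l a :=
  fun n hn => ha n (h.trans_lt hn)

theorem GeP.mono {k l : ℤ} {a : Ser N} (ha : GeP k a) (h : l ≤ k) : GeP l a :=
  fun n hn => ha n (hn.trans_le h)

theorem LeP.sub {k : ℤ} {a b : Ser N} (ha : LeP k a) (hb : LeP k b) : LeP k (a - b) :=
  fun n hn => by rw [toC_sub, Pi.sub_apply, ha n hn, hb n hn, sub_zero]

theorem LeP.add {k : ℤ} {a b : Ser N} (ha : LeP k a) (hb : LeP k b) : LeP k (a + b) :=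
  fun n hn => by rw [toC_add, Pi.add_apply, ha n hn, hb n hn, add_zero]

theorem GeP.sub {k : ℤ} {a b : Ser N} (ha : GeP k a) (hb : GeP k b) : GeP k (a - b) :=
  fun n hn => by rw [toC_sub, Pi.sub_apply, ha n hn, hb n hn, sub_zero]

theorem LeP.mul {k l : ℤ} {a b : Ser N} (ha : LeP k a) (hb : LeP l b) : LeP (k + l) (a * b) := by
  intro n hn
  funext x
  rw [toC_mul, DMKP.mul]
  refine (tsum_congr fun i => ?_).trans tsum_zero
  by_cases hi : k < i
  · simp [ha i hi]
  · simp [hb (n - i) (by omega)]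

theorem GeP.mul {k l : ℤ} {a b : Ser N} (ha : GeP k a) (hb : GeP l b) : GeP (k + l) (a * b) := by
  intro n hn
  funext x
  rw [toC_mul, DMKP.mul]
  refine (tsum_congr fun i => ?_).trans tsum_zero
  by_cases hi : i < k
  · simp [ha i hi]
  · simp [hb (n - i) (by omega)]

theorem LeP.derT {k : ℤ} {a : Ser N} (ha : LeP k a) (q : Fin N) : LeP k (derT q a) :=
  fun n hn => by rw [toC_derT, dT, ha n hn, pd_zero]

theorem GeP.derT {k : ℤ} {a : Ser N} (ha : GeP k a) (q : Fin N) : GeP k (derT q a) :=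
  fun n hn => by rw [toC_derT, dT, ha n hn, pd_zero]

theorem LeP.derP {k : ℤ} {a : Ser N} (ha : LeP k a) : LeP (k - 1) (derP a) := fun n hn => by
  funext x
  rw [toC_derP, dP, ha (n + 1) (by omega)]
  simp

theorem GeP.derP {k : ℤ} {a : Ser N} (ha : GeP k a) : GeP (k - 1) (derP a) := fun n hn => by
  funext x
  rw [toC_derP, dP, ha (n + 1) (by omega)]
  simp

theorem GeP.derP_zero {a : Ser N} (ha : GeP 0 a) : GeP 0 (DMKP.derP a) := fun n hn => by
  funext x
  rw [toC_derP, dP]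
  by_cases h : n + 1 = 0
  · simp [h]
  · simp [ha (n + 1) (by omega)]

theorem LeP.one : LeP 0 (1 : Ser N) := fun n hn => by
  rw [toC_one, one', if_neg (by omega)]

theorem GeP.one : GeP 0 (1 : Ser N) := fun n hn => by
  rw [toC_one, one', if_neg (by omega)]

theorem LeP.pow {k : ℤ} {a : Ser N} (ha : LeP k a) (j : ℕ) : LeP (j * k) (a ^ j) := by
  induction j with
  | zero => simpa using LeP.one
  | succ j ih =>
    rw [pow_succ]
    convert ih.mul ha using 1
    push_cast
    ring

theorem eq_of_LeP_of_GeP {k l : ℤ} {a b : Ser N} (hle : LeP k (a - b)) (ha : GeP l a)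
    (hb : GeP l b) (hkl : k < l) : a = b := by
  rw [← sub_eq_zero]
  apply toC_injective
  funext n
  by_cases h : n < l
  · exact (ha.sub hb) n h
  · exact hle n (by omega)

section Algebra

variable {B : Type*} [CommRing B]

theorem det_mul_of_det_eq_one {fP fX gP gX : B} (h : fP * gX - fX * gP = 1) (a b c d : B) :
    (fP * a + fX * b) * (gP * c + gX * d) - (fP * c + fX * d) * (gP * a + gX * b) =
      a * d - c * b := by
  linear_combination (a * d - c * b) * h

theorem cramer_fst {uP uX uT mP mX mT : B} (h : uP * mX - uX * mP = 1) :
    uT = (uP * mT - uT * mP) * uX - (uX * mT - uT * mX) * uP := by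
  linear_combination -uT * h

theorem cramer_snd {uP uX uT mP mX mT : B} (h : uP * mX - uX * mP = 1) :
    mT = (uP * mT - uT * mP) * mX - (uX * mT - uT * mX) * mP := by
  linear_combination -mT * h

theorem orlov_bracket_eq {uP uT rP rT c k p bP : B} :
    uP * (c * uT + k * p + rT) - uT * (c * uP + rP) - bP =
      k * p * uP - bP + uP * rT - uT * rP := by
  ring

theorem eq_mul_one_sub_of_mul_eq_one {a b p q : B} (hab : a * b = 1) (hqp : q * p = 1) :
    b = q * (1 - (a - p) * b) := by
  linear_combination q * hab - b * hqp

theorem derivation_map_sub [Algebra ℝ B] (D : Derivation ℝ B B) (a b : B) :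
    D (a - b) = D a - D b :=
  D.map_sub a b

end Algebra

/-- A canonical substitution preserves the bracket of any two derivations. -/
theorem bracket_evalL {f g : ℤ →₀ Polynomial ℝ} (hfg : lpP f * lpX g - lpX f * lpP g = 1)
    (D E : Derivation ℝ (Ser N) (Ser N)) (u : (Ser N)ˣ) (m : Ser N) :
    D (evalL u m (lp f)) * E (evalL u m (lp g)) - E (evalL u m (lp f)) * D (evalL u m (lp g)) =
      D (u : Ser N) * E m - E (u : Ser N) * D m := by
  have h := congrArg (evalL u m) hfg
  rw [map_one, map_sub, map_mul, map_mul] at h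
  rw [der_evalL_lp, der_evalL_lp, der_evalL_lp, der_evalL_lp]
  exact det_mul_of_det_eq_one (B := Ser N) h _ _ _ _

/-- The polynomial part `Σ n T_n a^{n-1}` of the Orlov function. -/
noncomputable def orlovPoly (a : Ser N) : Ser N :=
  ∑ q : Fin N, (((q : ℕ) + 1 : ℕ) : Ser N) * (tSer q * a ^ (q : ℕ))

theorem der_pow_succ (D : Derivation ℝ (Ser N) (Ser N)) (a : Ser N) (k : ℕ) :
    D (a ^ (k + 1)) = ((k + 1 : ℕ) : Ser N) * a ^ k * D a := by
  rw [D.leibniz_pow, Nat.add_sub_cancel, nsmul_eq_mul, smul_eq_mul, mul_assoc]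

theorem der_sub (D : Derivation ℝ (Ser N) (Ser N)) (a b : Ser N) : D (a - b) = D a - D b :=
  derivation_map_sub D a b

theorem exists_der_orlovPoly (a : Ser N) : ∃ c : Ser N, ∀ D : Derivation ℝ (Ser N) (Ser N),
    D (orlovPoly a) =
      c * D a + ∑ q : Fin N, (((q : ℕ) + 1 : ℕ) : Ser N) * (D (tSer q) * a ^ (q : ℕ)) := by
  refine ⟨∑ q : Fin N, (((q : ℕ) + 1 : ℕ) : Ser N) *
    (tSer q * (((q : ℕ) : Ser N) * a ^ ((q : ℕ) - 1))), fun D => ?_⟩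
  rw [orlovPoly, map_sum, Finset.sum_mul, ← Finset.sum_add_distrib]
  refine Finset.sum_congr rfl fun q _ => ?_
  rw [D.leibniz, D.leibniz, D.leibniz_pow, D.map_natCast, nsmul_eq_mul]
  simp only [smul_eq_mul]
  ring

theorem LeP_derT_of_leading_one {a : Ser N} (ha : LeP 1 a) (ha1 : toC a 1 = fun _ => 1)
    (q : Fin N) : LeP 0 (derT q a) := by
  intro n hn
  by_cases h : n = 1
  · funext x
    simp [toC_derT, dT, h, ha1, pd]
  · exact ha.derT q n (by omega)

theorem LeP_derP_sub_one {a : Ser N} (ha : LeP 1 a) (ha1 : toC a 1 = fun _ => 1) :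
    LeP (-1) (derP a - 1) := by
  intro n hn
  by_cases h : n = 0
  · funext x
    simp [toC_sub, toC_derP, toC_one, dP, h, ha1, one']
  · exact (ha.derP.sub LeP.one) n (by omega)

theorem LeP_orlov_bracket {l : ℤ} {uP uT rP rT c k p bP : Ser N} (h : LeP l (k * p * uP - bP))
    (hP : LeP l (uP * rT)) (hT : LeP l (uT * rP)) :
    LeP l (uP * (c * uT + k * p + rT) - uT * (c * uP + rP) - bP) := by
  rw [orlov_bracket_eq (B := Ser N)]
  exact (h.add hP).sub hT

section Hierarchy

variable {u : (Ser N)ˣ} {r m : Ser N} {f g : ℤ →₀ Polynomial ℝ}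

theorem derP_of_twistor (hu : LeP 1 (u : Ser N)) (hu1 : toC (u : Ser N) 1 = fun _ => 1)
    (hr : LeP (-1) r) (hm : m = orlovPoly (u : Ser N) + r)
    (hfg : lpP f * lpX g - lpX f * lpP g = 1) (hF : GeP 1 (evalL u m (lp f)))
    (hG : GeP 0 (evalL u m (lp g))) (q : Fin N) {b : Ser N} (hb : GeP 1 b)
    (hub : LeP 0 ((u : Ser N) ^ ((q : ℕ) + 1) - b)) :
    derP (u : Ser N) * derT q m - derT q (u : Ser N) * derP m = derP b := by
  obtain ⟨c, hc⟩ := exists_der_orlovPoly (u : Ser N)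
  have hP := hc derP
  have hT := hc (derT q)
  simp only [derP_tSer, derT_tSer, ite_mul, zero_mul, one_mul, mul_ite, mul_zero,
    Finset.sum_const_zero, Finset.sum_ite_eq, Finset.mem_univ, if_true] at hP hT
  rw [add_zero] at hP
  refine eq_of_LeP_of_GeP (k := -1) (l := 0) ?_ ?_ (hb.derP.mono (by norm_num)) (by norm_num)
  · rw [hm, map_add, map_add, hP, hT]
    refine LeP_orlov_bracket ?_ ((hu.derP.mul (hr.derT q)).mono (by norm_num))
      (((LeP_derT_of_leading_one hu hu1 q).mul hr.derP).mono (by norm_num))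
    rw [← der_pow_succ, ← der_sub]
    exact hub.derP.mono (by norm_num)
  · rw [← bracket_evalL hfg]
    exact ((hF.derP.mul (hG.derT q)).mono (by norm_num)).sub
      (((hF.derT q).mul hG.derP_zero).mono (by norm_num))

variable [NeZero N]

theorem pbr_eq_one_of_twistor (hu : LeP 1 (u : Ser N)) (hu1 : toC (u : Ser N) 1 = fun _ => 1)
    (hr : LeP (-1) r) (hm : m = orlovPoly (u : Ser N) + r)
    (hfg : lpP f * lpX g - lpX f * lpP g = 1) (hF : GeP 1 (evalL u m (lp f)))
    (hG : GeP 0 (evalL u m (lp g))) : pbr (u : Ser N) m = 1 := by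
  obtain ⟨c, hc⟩ := exists_der_orlovPoly (u : Ser N)
  have hP := hc derP
  have hX := hc (derT 0)
  simp only [derP_tSer, derT_tSer, ite_mul, zero_mul, one_mul, mul_ite, mul_zero,
    Finset.sum_const_zero, Finset.sum_ite_eq, Finset.mem_univ, if_true] at hP hX
  simp only [Fin.val_zero, zero_add, Nat.cast_one, pow_zero, mul_one, add_zero] at hP hX
  refine eq_of_LeP_of_GeP (k := -1) (l := 0) ?_ ?_ GeP.one (by omega)
  · have : pbr (u : Ser N) m - 1 =
        (derP (u : Ser N) - 1) + derP (u : Ser N) * derT 0 r - derT 0 (u : Ser N) * derP r := by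
      rw [pbr, hm, map_add, map_add, hP, hX]
      ring
    rw [this]
    exact ((LeP_derP_sub_one hu hu1).add ((hu.derP.mul (hr.derT 0)).mono (by omega))).sub
      (((LeP_derT_of_leading_one hu hu1 0).mul hr.derP).mono (by omega))
  · rw [pbr, ← bracket_evalL hfg]
    exact (hF.derP.mul (hG.derT 0)).sub (((hF.derT 0).mul hG.derP_zero).mono (by omega))

theorem derT_zero_of_twistor (hu : LeP 1 (u : Ser N)) (hu1 : toC (u : Ser N) 1 = fun _ => 1)
    (hr : LeP (-1) r) (hm : m = orlovPoly (u : Ser N) + r)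
    (hfg : lpP f * lpX g - lpX f * lpP g = 1) (hF : GeP 1 (evalL u m (lp f)))
    (hG : GeP 0 (evalL u m (lp g))) (q : Fin N) {b : Ser N} (hb : GeP 1 b)
    (hub : LeP 0 ((u : Ser N) ^ ((q : ℕ) + 1) - b)) :
    derT 0 (u : Ser N) * derT q m - derT q (u : Ser N) * derT 0 m = derT 0 b := by
  obtain ⟨c, hc⟩ := exists_der_orlovPoly (u : Ser N)
  have hX := hc (derT 0)
  have hT := hc (derT q)
  simp only [derT_tSer, ite_mul, zero_mul, one_mul, mul_ite, mul_zero,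
    Finset.sum_ite_eq, Finset.mem_univ, if_true] at hX hT
  simp only [Fin.val_zero, zero_add, Nat.cast_one, pow_zero, mul_one] at hX
  have hT0 (p : Fin N) := LeP_derT_of_leading_one hu hu1 p
  refine eq_of_LeP_of_GeP (k := 0) (l := 1) ?_ ?_ (hb.derT 0) (by norm_num)
  · rw [hm, map_add, map_add, hX, hT, add_assoc (c * _) 1]
    refine LeP_orlov_bracket ?_ (((hT0 0).mul (hr.derT q)).mono (by norm_num))
      (((hT0 q).mul (LeP.one.add ((hr.derT 0).mono (by norm_num)))).mono (by norm_num))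
    rw [← der_pow_succ, ← der_sub]
    exact hub.derT 0
  · rw [← bracket_evalL hfg]
    exact (((hF.derT 0).mul (hG.derT q)).mono (by norm_num)).sub
      (((hF.derT q).mul (hG.derT 0)).mono (by norm_num))

theorem hierarchy_of_twistor (hu : LeP 1 (u : Ser N)) (hu1 : toC (u : Ser N) 1 = fun _ => 1)
    (hr : LeP (-1) r) (hm : m = orlovPoly (u : Ser N) + r)
    (hfg : lpP f * lpX g - lpX f * lpP g = 1) (hF : GeP 1 (evalL u m (lp f)))
    (hG : GeP 0 (evalL u m (lp g))) (q : Fin N) {b : Ser N} (hb : GeP 1 b)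
    (hub : LeP 0 ((u : Ser N) ^ ((q : ℕ) + 1) - b)) :
    derT q (u : Ser N) = pbr b u ∧ derT q m = pbr b m := by
  have hone := pbr_eq_one_of_twistor hu hu1 hr hm hfg hF hG
  rw [pbr] at hone
  rw [pbr, pbr, ← derT_zero_of_twistor hu hu1 hr hm hfg hF hG q hb hub,
    ← derP_of_twistor hu hu1 hr hm hfg hF hG q hb hub]
  exact ⟨cramer_fst (B := Ser N) hone, cramer_snd (B := Ser N) hone⟩

end Hierarchy

theorem LeP_neg_one_units_inv {u : (Ser N)ˣ} (hu : LeP 1 (u : Ser N))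
    (hu1 : toC (u : Ser N) 1 = fun _ => 1) : LeP (-1) ((u⁻¹ : (Ser N)ˣ) : Ser N) := by
  set b : Ser N := ((u⁻¹ : (Ser N)ˣ) : Ser N)
  have hub : (u : Ser N) * b = 1 := u.mul_inv
  have hp (j : ℤ) : LeP j ((pUnit ^ j : (Ser N)ˣ) : Ser N) := fun n hn => by
    rw [pUnit_zpow, toC, HahnSeries.coeff_single_of_ne (by omega)]
    rfl
  have hsub : LeP 0 ((u : Ser N) - ((pUnit : (Ser N)ˣ) : Ser N)) := by
    intro n hn
    by_cases h : n = 1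
    · funext x
      rw [toC_sub, h, Pi.sub_apply, hu1]
      simp [toC, pUnit]
    · have := hp 1
      rw [zpow_one] at this
      exact (hu.sub this) n (by omega)
  have hb : b = ((pUnit ^ (-1 : ℤ) : (Ser N)ˣ) : Ser N) *
      (1 - ((u : Ser N) - ((pUnit : (Ser N)ˣ) : Ser N)) * b) := by
    have h : ((pUnit ^ (-1 : ℤ) : (Ser N)ˣ) : Ser N) * ((pUnit : (Ser N)ˣ) : Ser N) = 1 := by
      rw [zpow_neg_one, Units.inv_mul]
    exact eq_mul_one_sub_of_mul_eq_one (B := Ser N) hub h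
  have hstep (k : ℕ) : LeP (k - 1) b → LeP (-1) b := by
    induction k with
    | zero => exact fun h => by simpa using h
    | succ k ih =>
      intro h
      apply ih
      rw [hb]
      exact ((hp (-1)).mul ((LeP.one.mono (l := k) (by omega)).sub
        ((hsub.mul h).mono (by push_cast; omega)))).mono (by omega)
  obtain ⟨s, hs⟩ : ∃ s : ℤ, LeP s b := by
    by_cases h0 : b = 0
    · exact ⟨0, fun n _ => by rw [h0]; rfl⟩
    · refine ⟨-b.order, fun n hn => ?_⟩
      rw [toC, HahnSeries.coeff_eq_zero_of_lt_order (by omega)]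
      rfl
  exact hstep (s + 1).toNat (hs.mono (by omega))

theorem toC_orlovPoly (a : Ser N) (n : ℤ) (x : Fin N → ℝ) :
    toC (orlovPoly a) n x =
      ∑ q : Fin N, (((q : ℕ) + 1 : ℕ) : ℝ) * x q * powC (toC a) (q : ℕ) n x := by
  rw [orlovPoly, toC_sum, Finset.sum_apply, Finset.sum_apply]
  refine Finset.sum_congr rfl fun q _ => ?_
  rw [← toC_pow, ← nsmul_eq_mul, tSer, toC, HahnSeries.coeff_smul, HahnSeries.C_mul_eq_smul,
    HahnSeries.coeff_smul, mul_assoc]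
  simp [toC]

/-- The tail `Σ S_i b^i` of the Orlov function is a Laurent series in strictly negative powers. -/
theorem exists_orlov_tail {b : Ser N} (hb : LeP (-1) b) {S : ℕ → (Fin N → ℝ) → ℝ}
    (hS : ∀ i : ℕ, ContDiff ℝ (⊤ : ℕ∞) (S i)) :
    ∃ r : Ser N, LeP (-1) r ∧
      ∀ n x, toC r n x = ∑' i : ℕ, S (i + 1) x * powC (toC b) (i + 1) n x := by
  have hfin (n : ℤ) (x : Fin N → ℝ) : ∑' i : ℕ, S (i + 1) x * powC (toC b) (i + 1) n x =
      ∑ i ∈ Finset.range (-n).toNat, S (i + 1) x * powC (toC b) (i + 1) n x := by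
    refine tsum_eq_sum fun i hi => ?_
    rw [Finset.mem_range] at hi
    rw [← toC_pow, hb.pow (i + 1) n (by push_cast; omega)]
    exact mul_zero _
  have hzero (n : ℤ) (hn : -1 < n) :
      (fun x => ∑' i : ℕ, S (i + 1) x * powC (toC b) (i + 1) n x) = 0 := by
    funext x
    rw [hfin, Int.toNat_of_nonpos (by omega)]
    rfl
  obtain ⟨r, hr⟩ := exists_toC_eq
    (A := fun n x => ∑' i : ℕ, S (i + 1) x * powC (toC b) (i + 1) n x) (by
      refine ⟨⟨-1, hzero⟩, fun n => ?_⟩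
      simp only [hfin]
      refine ContDiff.sum fun i _ => (hS _).mul ?_
      rw [← toC_pow]
      exact mem_smoothFn.1 (Subtype.property _))
  exact ⟨r, fun n hn => by rw [hr]; exact hzero n hn, fun n x => by rw [hr]⟩

/-- Theorem 11, twistor construction for dmKP: if `{f,g} = 1` and the
functional equations `f(μ,M)_{≤0} = 0`, `g(μ,M)_{≤-1} = 0` hold, then `(μ,M)` solves the
dmKP hierarchy: `∂_{T_q}μ = {(μ^q)_{≥1}, μ}`, `∂_{T_q}M = {(μ^q)_{≥1}, M}` and
`{μ,M} = 1` (`q : Fin N` labels the time `T_{q+1}`, paired with the exponent `q+1`). -/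
theorem statement16 {N : ℕ} [NeZero N] (mu muinv : Coeffs N)
    (hmu : IsLaurent mu) (hshape : IsDMKPShape mu)
    (hmuinv : IsLaurent muinv) (hinv : mul mu muinv = one') (hinv' : mul muinv mu = one')
    (S : ℕ → (Fin N → ℝ) → ℝ) (hS : ∀ i : ℕ, ContDiff ℝ (⊤ : ℕ∞) (S i))
    (M : Coeffs N) (hM : M = orlov mu muinv S)
    (f g : ℤ →₀ Polynomial ℝ)
    (hcanon : pb (polyToCoeffs (N := N) f) (polyToCoeffs g) = one')
    (hf : truncLe 0 (substC f mu muinv M) = 0)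
    (hg : truncLe (-1) (substC g mu muinv M) = 0) :
    ∀ q : Fin N,
      dT q mu = pb (truncGe 1 (powC mu ((q : ℕ) + 1))) mu ∧
      dT q M = pb (truncGe 1 (powC mu ((q : ℕ) + 1))) M ∧
      pb mu M = one' := by
  obtain ⟨a, rfl⟩ := exists_toC_eq hmu
  obtain ⟨b, rfl⟩ := exists_toC_eq hmuinv
  rw [← toC_mul, ← toC_one] at hinv hinv'
  obtain ⟨u, rfl, rfl⟩ : ∃ u : (Ser N)ˣ, (u : Ser N) = a ∧ ((u⁻¹ : (Ser N)ˣ) : Ser N) = b :=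
    ⟨⟨a, b, toC_injective hinv, toC_injective hinv'⟩, rfl, rfl⟩
  have hu : LeP 1 (u : Ser N) := fun n hn => hshape.2 n (by omega)
  obtain ⟨r, hr, hrS⟩ := exists_orlov_tail (LeP_neg_one_units_inv hu hshape.1) hS
  have hMm : M = toC (orlovPoly (u : Ser N) + r) := by
    rw [hM]
    funext n x
    rw [toC_add, Pi.add_apply, Pi.add_apply, toC_orlovPoly, hrS]
    rfl
  subst hMm
  rw [← toC_evalL_lp] at hf hg
  have hfg := canonical_lp hcanon
  have hF : GeP 1 (evalL u (orlovPoly (u : Ser N) + r) (lp f)) := fun n hn => by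
    simpa [truncLe, show n ≤ 0 by omega] using congrFun hf n
  have hG : GeP 0 (evalL u (orlovPoly (u : Ser N) + r) (lp g)) := fun n hn => by
    simpa [truncLe, show n ≤ -1 by omega] using congrFun hg n
  intro q
  obtain ⟨b, hb⟩ : ∃ b : Ser N, toC b = truncGe 1 (powC (toC u) ((q : ℕ) + 1)) := by
    rw [← toC_pow]
    refine exists_toC_eq ⟨⟨((q : ℕ) + 1 : ℕ) * 1, fun n hn => ?_⟩, fun n => ?_⟩
    · rw [truncGe, hu.pow _ n hn, ite_self]
    · unfold truncGe
      split_ifs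
      · exact mem_smoothFn.1 (Subtype.property _)
      · exact contDiff_const
  have hb1 : GeP 1 b := fun n hn => by rw [hb, truncGe, if_neg (by omega)]
  have hub : LeP 0 ((u : Ser N) ^ ((q : ℕ) + 1) - b) := fun n hn => by
    rw [toC_sub, Pi.sub_apply, hb, truncGe, if_pos (by omega), toC_pow, sub_self]
  obtain ⟨h1, h2⟩ := hierarchy_of_twistor hu hshape.1 hr rfl hfg hF hG q hb1 hub
  rw [← hb, ← toC_pbr, ← toC_pbr, ← toC_pbr, ← toC_derT, ← toC_derT, ← toC_one]
  exact ⟨congrArg toC h1, congrArg toC h2,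
    congrArg toC (pbr_eq_one_of_twistor hu hshape.1 hr rfl hfg hF hG)⟩

end DMKP
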